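/- (Howe duality) As a module over gl_k ⊕ gl_n, the polynomial ring P_{kn} = C[x_{ai} : 1 ≤ a ≤ k, 1 ≤ i ≤ n] decomposes as the direct sum, over all partitions λ with at most min(k,n) parts, of V_λ^{(k)} ⊗ V_λ^{(n)}, where V_λ^{(k)} and V_λ^{(n)} are the irreducible highest weight modules of gl_k and gl_n with highest weight λ. -/

import Mathlib

open MvPolynomial

/-- The `gl_k`-action on `P_{kn} = ℂ[x_{ai}]`: `e_{ab} ↦ Σ_i x_{ai} ∂_{bi}`. -/
noncomputable def glkOp (k n : ℕ) (a b : Fin k) :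
    Module.End ℂ (MvPolynomial (Fin k × Fin n) ℂ) :=
  ∑ i : Fin n,
    (LinearMap.mulLeft ℂ (X (a, i) : MvPolynomial (Fin k × Fin n) ℂ)) ∘ₗ
      (pderiv (b, i) : Derivation ℂ (MvPolynomial (Fin k × Fin n) ℂ)
        (MvPolynomial (Fin k × Fin n) ℂ)).toLinearMap

/-- The `gl_n`-action on `P_{kn} = ℂ[x_{ai}]`: `e_{ij} ↦ Σ_a x_{ai} ∂_{aj}`. -/
noncomputable def glnOp (k n : ℕ) (i j : Fin n) :
    Module.End ℂ (MvPolynomial (Fin k × Fin n) ℂ) :=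
  ∑ a : Fin k,
    (LinearMap.mulLeft ℂ (X (a, i) : MvPolynomial (Fin k × Fin n) ℂ)) ∘ₗ
      (pderiv (a, j) : Derivation ℂ (MvPolynomial (Fin k × Fin n) ℂ)
        (MvPolynomial (Fin k × Fin n) ℂ)).toLinearMap

/-- Partitions with at most `min k n` parts. -/
def PartitionKN (k n : ℕ) := {mu : Fin (min k n) → ℕ // Antitone mu}

instance (k n : ℕ) : DecidableEq (PartitionKN k n) :=
  Subtype.instDecidableEq

/-- A partition with at most `min k n` parts, read as a `gl_k`-weight (extended
by zeros). -/
def wtK (k n : ℕ) (mu : PartitionKN k n) (a : Fin k) : ℕ :=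
  if h : (a : ℕ) < min k n then mu.1 ⟨a, h⟩ else 0

/-- A partition with at most `min k n` parts, read as a `gl_n`-weight (extended
by zeros). -/
def wtN (k n : ℕ) (mu : PartitionKN k n) (i : Fin n) : ℕ :=
  if h : (i : ℕ) < min k n then mu.1 ⟨i, h⟩ else 0

/-! ### Determinants and polynomials -/

theorem Derivation.map_prod_eq_sum_ite {R A : Type*} [CommRing R] [CommRing A] [Algebra R A]
    (D : Derivation R A A) {κ : Type*} [DecidableEq κ] (s : Finset κ) (f : κ → A) :
    D (∏ i ∈ s, f i) = ∑ j ∈ s, ∏ i ∈ s, (if i = j then D (f i) else f i) := by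
  induction s using Finset.induction_on with
  | empty => simp
  | insert a s ha ih =>
    have h1 : ∏ i ∈ s, (if i = a then D (f i) else f i) = ∏ i ∈ s, f i :=
      Finset.prod_congr rfl fun i hi => if_neg (ne_of_mem_of_not_mem hi ha)
    have h2 : ∀ j ∈ s, ∏ i ∈ insert a s, (if i = j then D (f i) else f i) =
        f a * ∏ i ∈ s, (if i = j then D (f i) else f i) := fun j hj => by
      rw [Finset.prod_insert ha, if_neg (ne_of_mem_of_not_mem hj ha).symm]
    rw [Finset.prod_insert ha, D.leibniz, ih, Finset.sum_insert ha, Finset.prod_insert ha, h1,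
      if_pos rfl, Finset.sum_congr rfl h2, ← Finset.mul_sum, smul_eq_mul, smul_eq_mul]
    ring

theorem Derivation.map_det {R A : Type*} [CommRing R] [CommRing A] [Algebra R A]
    (D : Derivation R A A) {κ : Type*} [Fintype κ] [DecidableEq κ] (M : Matrix κ κ A) :
    D M.det = ∑ r, (M.updateRow r fun c => D (M r c)).det := by
  rw [← Matrix.det_transpose, Matrix.det_apply, map_sum]
  conv_rhs =>
    enter [2, r]
    rw [← Matrix.det_transpose, Matrix.det_apply]
  rw [Finset.sum_comm]
  refine Finset.sum_congr rfl fun τ _ => ?_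
  rw [Units.smul_def, map_zsmul, Derivation.map_prod_eq_sum_ite, Finset.smul_sum]
  refine Finset.sum_congr rfl fun r _ => ?_
  rw [Units.smul_def]
  congr 1
  refine Finset.prod_congr rfl fun i _ => ?_
  simp only [Matrix.transpose_apply, Matrix.updateRow_apply]
  split_ifs with h
  · rw [h]
  · rfl

theorem Derivation.map_prod_pow_of_eigen {A : Type*} [CommRing A] [Algebra ℂ A]
    (D : Derivation ℂ A A) {κ : Type*} (s : Finset κ) (f : κ → A) (c : κ → ℂ)
    (h : ∀ i, D (f i) = c i • f i) (γ : κ → ℕ) :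
    D (∏ i ∈ s, f i ^ γ i) = (∑ i ∈ s, (γ i : ℂ) * c i) • ∏ i ∈ s, f i ^ γ i := by
  classical
  induction s using Finset.induction_on with
  | empty => simp
  | insert a s ha ih =>
    have hp : D (f a ^ γ a) = ((γ a : ℂ) * c a) • f a ^ γ a := by
      rw [D.leibniz_pow, h]
      cases γ a with
      | zero => simp
      | succ m =>
        rw [Nat.add_sub_cancel, ← Nat.cast_smul_eq_nsmul ℂ]
        simp only [Algebra.smul_def, map_mul, Algebra.algebraMap_self, RingHom.id_apply]
        ring
    rw [Finset.prod_insert ha, Finset.sum_insert ha, D.leibniz, ih, hp]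
    simp only [smul_eq_mul, Algebra.smul_def, map_add]
    ring

/-- A polynomial annihilated by a derivation is constant along a straight integral curve. -/
theorem eval_add_of_mkDerivation {σ : Type*} (l : σ → MvPolynomial σ ℂ) (A B : σ → ℂ)
    (h : ∀ (t : ℂ) s, eval (A + t • B) (l s) = B s) (f : MvPolynomial σ ℂ)
    (hf : mkDerivation ℂ l f = 0) : eval (A + B) f = eval A f := by
  let φ : MvPolynomial σ ℂ →ₐ[ℂ] Polynomial ℂ :=
    aeval fun s => Polynomial.C (A s) + Polynomial.X * Polynomial.C (B s)
  have hev : ∀ t p, (φ p).eval t = eval (A + t • B) p := by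
    intro t p
    induction p using MvPolynomial.induction_on with
    | C a => simp [φ]
    | add p q hp hq => simp [hp, hq]
    | mul_X p s hp => rw [map_mul, Polynomial.eval_mul, hp]; simp [φ, mul_comm t]
  have hder : ∀ p, (φ p).derivative = φ (mkDerivation ℂ l p) := by
    intro p
    induction p using MvPolynomial.induction_on with
    | C a => simp [φ]
    | add p q hp hq => simp [hp, hq]
    | mul_X p s hp =>
      have hs : φ (l s) = Polynomial.C (B s) := Polynomial.funext fun t => by
        rw [hev, h, Polynomial.eval_C]
      have hX : φ (X s) = Polynomial.C (A s) + Polynomial.X * Polynomial.C (B s) := aeval_X _ _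
      rw [map_mul, Polynomial.derivative_mul, hp, Derivation.leibniz, mkDerivation_X, map_add,
        smul_eq_mul, smul_eq_mul, map_mul, map_mul, hs, hX]
      simp
      ring
  have h0 : (φ f).derivative = 0 := by rw [hder, hf, map_zero]
  have hC := Polynomial.eq_C_of_natDegree_eq_zero
    (Polynomial.derivative_eq_zero.mp h0)
  have h1 := hev 1 f
  have h2 := hev 0 f
  rw [hC, Polynomial.eval_C] at h1 h2
  rw [one_smul] at h1
  rw [zero_smul, add_zero] at h2
  rw [← h1, ← h2]

/-! ### The Fischer inner product -/

section Fischer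

variable {σ : Type*} [Fintype σ]

/-- The Fischer inner product, for which `x^α` has square norm `α!` and distinct monomials are
orthogonal. It is conjugate-linear in the first variable. -/
noncomputable def fischer (f g : MvPolynomial σ ℂ) : ℂ :=
  ∑ α ∈ f.support, ((∏ s, (α s).factorial : ℕ) : ℂ) * star (coeff α f) * coeff α g

theorem fischer_eq_sum_of_subset {f : MvPolynomial σ ℂ} {T : Finset (σ →₀ ℕ)}
    (hT : f.support ⊆ T) (g : MvPolynomial σ ℂ) :
    fischer f g = ∑ α ∈ T, ((∏ s, (α s).factorial : ℕ) : ℂ) * star (coeff α f) * coeff α g :=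
  Finset.sum_subset hT fun α _ hα => by simp [notMem_support_iff.mp hα]

theorem fischer_add_right (f g h : MvPolynomial σ ℂ) :
    fischer f (g + h) = fischer f g + fischer f h := by
  simp [fischer, mul_add, Finset.sum_add_distrib]

theorem fischer_smul_right (c : ℂ) (f g : MvPolynomial σ ℂ) :
    fischer f (c • g) = c * fischer f g := by
  simp only [fischer, coeff_smul, Finset.mul_sum, smul_eq_mul]
  exact Finset.sum_congr rfl fun _ _ => by ring

theorem fischer_zero_right (f : MvPolynomial σ ℂ) : fischer f 0 = 0 := by simp [fischer]

theorem star_fischer (f g : MvPolynomial σ ℂ) : star (fischer f g) = fischer g f := by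
  classical
  rw [fischer_eq_sum_of_subset (f := f) Finset.subset_union_left,
    fischer_eq_sum_of_subset (f := g) (Finset.subset_union_right (s₁ := f.support)), star_sum]
  refine Finset.sum_congr rfl fun α _ => ?_
  simp only [star_mul', star_star, star_natCast]
  ring

theorem fischer_add_left (f g h : MvPolynomial σ ℂ) :
    fischer (f + g) h = fischer f h + fischer g h := by
  rw [← star_fischer, fischer_add_right, star_add, star_fischer, star_fischer]

theorem fischer_smul_left (c : ℂ) (f g : MvPolynomial σ ℂ) :
    fischer (c • f) g = star c * fischer f g := by
  rw [← star_fischer, fischer_smul_right, star_mul', star_fischer]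

theorem fischer_zero_left (f : MvPolynomial σ ℂ) : fischer 0 f = 0 := by simp [fischer]

theorem fischer_monomial_left (α : σ →₀ ℕ) (c : ℂ) (g : MvPolynomial σ ℂ) :
    fischer (monomial α c) g = ((∏ s, (α s).factorial : ℕ) : ℂ) * star c * coeff α g := by
  classical
  rw [fischer_eq_sum_of_subset support_monomial_subset, Finset.sum_singleton, coeff_monomial,
    if_pos rfl]

theorem fischer_self (f : MvPolynomial σ ℂ) :
    fischer f f =
      ((∑ α ∈ f.support, ((∏ s, (α s).factorial : ℕ) : ℝ) * ‖coeff α f‖ ^ 2 : ℝ) : ℂ) := by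
  rw [fischer, Complex.ofReal_sum]
  refine Finset.sum_congr rfl fun α _ => ?_
  rw [mul_assoc, Complex.star_def, Complex.conj_mul']
  push_cast
  rfl

theorem eq_zero_of_fischer_self {f : MvPolynomial σ ℂ} (h : fischer f f = 0) : f = 0 := by
  rw [fischer_self, Complex.ofReal_eq_zero, Finset.sum_eq_zero_iff_of_nonneg
    (fun _ _ => by positivity)] at h
  ext α
  by_contra hα
  have hpos : (0 : ℝ) < ((∏ s, (α s).factorial : ℕ) : ℝ) :=
    Nat.cast_pos.mpr (Finset.prod_pos fun s _ => Nat.factorial_pos _)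
  have := h α (mem_support_iff.mpr hα)
  rcases mul_eq_zero.mp this with h1 | h1
  · exact hpos.ne' h1
  · exact hα (by simpa using h1)

/-- Multiplication by a variable is adjoint to the corresponding partial derivative. -/
theorem fischer_X_mul (s : σ) (f g : MvPolynomial σ ℂ) :
    fischer (X s * f) g = fischer f (pderiv s g) := by
  classical
  induction f using MvPolynomial.induction_on' with
  | add p q hp hq => rw [mul_add, fischer_add_left, fischer_add_left, hp, hq]
  | monomial α c =>
    have hfac : (∏ t, ((α + Finsupp.single s 1 : σ →₀ ℕ) t).factorial) =
        (α s + 1) * ∏ t, (α t).factorial := by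
      rw [← Finset.mul_prod_erase _ _ (Finset.mem_univ s),
        ← Finset.mul_prod_erase _ (fun t => (α t).factorial) (Finset.mem_univ s), ← mul_assoc]
      congr 1
      · simp [Nat.factorial_succ]
      · refine Finset.prod_congr rfl fun t ht => ?_
        simp [(Finset.ne_of_mem_erase ht).symm]
    rw [X, monomial_mul, one_mul, add_comm, fischer_monomial_left, fischer_monomial_left,
      coeff_pderiv, hfac]
    push_cast
    ring

/-- The orthogonal complement of a set for the Fischer inner product. -/
noncomputable def fischerPerp (K : Set (MvPolynomial σ ℂ)) :
    Submodule ℂ (MvPolynomial σ ℂ) where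
  carrier := {f | ∀ g ∈ K, fischer g f = 0}
  add_mem' hf hg k hk := by rw [fischer_add_right, hf k hk, hg k hk, add_zero]
  zero_mem' k _ := fischer_zero_right k
  smul_mem' c f hf k hk := by rw [fischer_smul_right, hf k hk, mul_zero]

theorem mem_fischerPerp {K : Set (MvPolynomial σ ℂ)} {f : MvPolynomial σ ℂ} :
    f ∈ fischerPerp K ↔ ∀ g ∈ K, fischer g f = 0 := Iff.rfl

theorem fischer_eq_zero_comm {f g : MvPolynomial σ ℂ} : fischer f g = 0 ↔ fischer g f = 0 := by
  rw [← star_fischer g f, star_eq_zero]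

theorem fischerPerp_sub_mem_of_finite (K : Submodule ℂ (MvPolynomial σ ℂ))
    [FiniteDimensional ℂ K] (p : MvPolynomial σ ℂ) :
    ∃ q ∈ K, p - q ∈ fischerPerp (K : Set (MvPolynomial σ ℂ)) := by
  let core : InnerProductSpace.Core ℂ (MvPolynomial σ ℂ) :=
    { inner := fischer
      conj_inner_symm := fun x y => star_fischer y x
      re_inner_nonneg := fun x => by
        rw [fischer_self]
        exact Finset.sum_nonneg fun _ _ => by positivity
      add_left := fischer_add_left
      smul_left := fun x y r => fischer_smul_left r x y
      definite := fun x hx => eq_zero_of_fischer_self hx }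
  let _ : NormedAddCommGroup (MvPolynomial σ ℂ) :=
    @InnerProductSpace.Core.toNormedAddCommGroup ℂ _ _ _ _ core
  let _ : InnerProductSpace ℂ (MvPolynomial σ ℂ) := InnerProductSpace.ofCore core.toCore
  exact ⟨K.starProjection p, K.starProjection_apply_mem p, fun g hg =>
    K.sub_starProjection_mem_orthogonal p g hg⟩

end Fischer

/-! ### The operators of the two actions -/

section Operators

variable {k n : ℕ}

/-- Index set of the matrix units of `gl_k ⊕ gl_n`. -/
abbrev HoweIndex (k n : ℕ) := (Fin k × Fin k) ⊕ (Fin n × Fin n)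

/-- The action of a matrix unit of `gl_k ⊕ gl_n` as a derivation. -/
noncomputable def howeDer (k n : ℕ) : HoweIndex k n →
    Derivation ℂ (MvPolynomial (Fin k × Fin n) ℂ) (MvPolynomial (Fin k × Fin n) ℂ)
  | .inl p => ∑ i : Fin n, (X (p.1, i) : MvPolynomial (Fin k × Fin n) ℂ) • pderiv (p.2, i)
  | .inr p => ∑ a : Fin k, (X (a, p.1) : MvPolynomial (Fin k × Fin n) ℂ) • pderiv (a, p.2)

theorem Derivation.finset_sum_apply {R A κ : Type*} [CommRing R] [CommRing A] [Algebra R A]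
    (S : Finset κ) (D : κ → Derivation R A A) (f : A) : (∑ c ∈ S, D c) f = ∑ c ∈ S, D c f :=
  (congrFun (map_sum Derivation.coeFnAddMonoidHom D S) f).trans (Finset.sum_apply _ _ _)

theorem glkOp_apply (a b : Fin k) (f : MvPolynomial (Fin k × Fin n) ℂ) :
    glkOp k n a b f = howeDer k n (.inl (a, b)) f := by
  simp [glkOp, howeDer, LinearMap.sum_apply, Derivation.finset_sum_apply]

theorem glnOp_apply (i j : Fin n) (f : MvPolynomial (Fin k × Fin n) ℂ) :
    glnOp k n i j f = howeDer k n (.inr (i, j)) f := by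
  simp [glnOp, howeDer, LinearMap.sum_apply, Derivation.finset_sum_apply]

theorem howeDer_inl_X (p : Fin k × Fin k) (s : Fin k × Fin n) :
    howeDer k n (.inl p) (X s) = if s.1 = p.2 then X (p.1, s.2) else 0 := by
  obtain ⟨c, i⟩ := s
  by_cases h : c = p.2 <;>
    simp [howeDer, Derivation.finset_sum_apply, Pi.single_apply, h]

theorem howeDer_inr_X (p : Fin n × Fin n) (s : Fin k × Fin n) :
    howeDer k n (.inr p) (X s) = if s.2 = p.2 then X (s.1, p.1) else 0 := by
  obtain ⟨c, i⟩ := s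
  by_cases h : i = p.2 <;>
    simp [howeDer, Derivation.finset_sum_apply, Pi.single_apply, h]

/-- Transposition of matrix units. -/
def HoweIndex.swap : HoweIndex k n → HoweIndex k n := Sum.map Prod.swap Prod.swap

/-- The matrix units strictly above the diagonal. -/
def HoweIndex.Raising : HoweIndex k n → Prop :=
  Sum.elim (fun p => p.1 < p.2) (fun p => p.1 < p.2)

theorem HoweIndex.swap_swap (x : HoweIndex k n) : x.swap.swap = x := by
  rcases x with x | x <;> rfl

theorem fischer_howeDer (x : HoweIndex k n) (f g : MvPolynomial (Fin k × Fin n) ℂ) :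
    fischer (howeDer k n x f) g = fischer f (howeDer k n x.swap g) := by
  have key : ∀ s t : Fin k × Fin n, fischer (X s * pderiv t f) g =
      fischer f (X t * pderiv s g) := fun s t => by
    rw [fischer_X_mul, ← star_fischer _ f, fischer_X_mul, star_fischer]
  have hl : ∀ {κ : Type} (S : Finset κ) (F : κ → MvPolynomial (Fin k × Fin n) ℂ),
      fischer (∑ c ∈ S, F c) g = ∑ c ∈ S, fischer (F c) g := fun S F =>
    map_sum (⟨⟨fun f => fischer f g, fischer_zero_left g⟩, fun f h => fischer_add_left f h g⟩ :
      MvPolynomial (Fin k × Fin n) ℂ →+ ℂ) F S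
  have hr : ∀ {κ : Type} (S : Finset κ) (F : κ → MvPolynomial (Fin k × Fin n) ℂ),
      fischer f (∑ c ∈ S, F c) = ∑ c ∈ S, fischer f (F c) := fun S F =>
    map_sum (⟨⟨fun g => fischer f g, fischer_zero_right f⟩, fun h g => fischer_add_right f h g⟩ :
      MvPolynomial (Fin k × Fin n) ℂ →+ ℂ) F S
  rcases x with ⟨a, b⟩ | ⟨a, b⟩ <;>
    simp [howeDer, HoweIndex.swap, Derivation.finset_sum_apply, hl, hr, key]

theorem howeDer_lie_mem (x y : HoweIndex k n) :
    ⁅howeDer k n x, howeDer k n y⁆ ∈ Submodule.span ℂ (Set.range (howeDer k n)) := by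
  have hm : ∀ (P : Prop) [Decidable P] z, (if P then howeDer k n z else 0) ∈
      Submodule.span ℂ (Set.range (howeDer k n)) := fun P _ z => by
    split_ifs
    · exact Submodule.subset_span ⟨z, rfl⟩
    · exact Submodule.zero_mem _
  have hap : ∀ (P : Prop) [Decidable P] z f,
      (if P then howeDer k n z else 0) f = if P then howeDer k n z f else 0 := fun P _ z f => by
    split_ifs <;> rfl
  have hl : ∀ (P : Prop) [Decidable P] p s, howeDer k n (.inl p) (if P then X s else 0) =
      if P then (if s.1 = p.2 then X (p.1, s.2) else 0) else 0 := fun P _ p s => by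
    rw [apply_ite (howeDer k n _), map_zero, howeDer_inl_X]
  have hr : ∀ (P : Prop) [Decidable P] p s, howeDer k n (.inr p) (if P then X s else 0) =
      if P then (if s.2 = p.2 then X (s.1, p.1) else 0) else 0 := fun P _ p s => by
    rw [apply_ite (howeDer k n _), map_zero, howeDer_inr_X]
  rcases x with ⟨a, b⟩ | ⟨a, b⟩ <;> rcases y with ⟨c, d⟩ | ⟨c, d⟩
  · convert Submodule.sub_mem _ (hm (c = b) (.inl (a, d))) (hm (a = d) (.inl (c, b))) using 1
    refine derivation_ext fun s => ?_
    rw [Derivation.commutator_apply, Derivation.sub_apply]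
    simp only [hap, howeDer_inl_X, hl]
    split_ifs <;> grind
  · convert Submodule.zero_mem _ using 1
    refine derivation_ext fun s => ?_
    rw [Derivation.commutator_apply, Derivation.zero_apply]
    simp only [howeDer_inl_X, howeDer_inr_X, hl, hr]
    split_ifs <;> exact sub_self _
  · convert Submodule.zero_mem _ using 1
    refine derivation_ext fun s => ?_
    rw [Derivation.commutator_apply, Derivation.zero_apply]
    simp only [howeDer_inl_X, howeDer_inr_X, hl, hr]
    split_ifs <;> exact sub_self _
  · convert Submodule.sub_mem _ (hm (c = b) (.inr (a, d))) (hm (a = d) (.inr (c, b))) using 1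
    refine derivation_ext fun s => ?_
    rw [Derivation.commutator_apply, Derivation.sub_apply]
    simp only [hap, howeDer_inr_X, hr]
    split_ifs <;> grind

/-- A weight filtration of the polynomial ring: the polynomials all of whose monomials have
weight less than `m`. -/
noncomputable def weightLT (w : Fin k × Fin n → ℕ) (m : ℕ) :
    Submodule ℂ (MvPolynomial (Fin k × Fin n) ℂ) where
  carrier := {f | ∀ α : Fin k × Fin n →₀ ℕ, m ≤ Finsupp.weight w α → coeff α f = 0}
  add_mem' hf hg α hα := by rw [coeff_add, hf α hα, hg α hα, add_zero]
  zero_mem' α _ := coeff_zero α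
  smul_mem' c f hf α hα := by rw [coeff_smul, hf α hα, smul_zero]

theorem X_mul_pderiv_mem_weightLT {w : Fin k × Fin n → ℕ} {m d : ℕ} {s t : Fin k × Fin n}
    (hst : w s + d ≤ w t) {f : MvPolynomial (Fin k × Fin n) ℂ} (hf : f ∈ weightLT w (m + d)) :
    X s * pderiv t f ∈ weightLT w m := by
  intro α hα
  rw [coeff_X_mul']
  split_ifs with hs
  · have hle : Finsupp.single s 1 ≤ α := by
      rw [Finsupp.single_le_iff]
      exact Nat.one_le_iff_ne_zero.mpr (Finsupp.mem_support_iff.mp hs)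
    rw [coeff_pderiv, hf, zero_mul]
    have h := congrArg (Finsupp.weight w) (tsub_add_cancel_of_le hle)
    rw [map_add, Finsupp.weight_single, one_smul] at h
    rw [map_add, Finsupp.weight_single, one_smul]
    omega
  · rfl

theorem exists_mem_weightLT (w : Fin k × Fin n → ℕ) (f : MvPolynomial (Fin k × Fin n) ℂ) :
    ∃ m, f ∈ weightLT w m := by
  refine ⟨f.support.sup (Finsupp.weight w) + 1, fun α hα => ?_⟩
  by_contra h
  have := Finset.le_sup (f := Finsupp.weight w) (mem_support_iff.mpr h)
  omega

theorem howeDer_mem_weightLT_of_raising {x : HoweIndex k n} (hx : x.Raising) {m : ℕ}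
    {f : MvPolynomial (Fin k × Fin n) ℂ}
    (hf : f ∈ weightLT (fun s => (s.1 : ℕ) + s.2) (m + 1)) :
    howeDer k n x f ∈ weightLT (fun s => (s.1 : ℕ) + s.2) m := by
  rcases x with ⟨a, b⟩ | ⟨a, b⟩ <;>
  · have hab : (a : ℕ) < b := hx
    rw [howeDer, Derivation.finset_sum_apply]
    exact Submodule.sum_mem _ fun c _ => X_mul_pderiv_mem_weightLT (by simp only; omega) hf

theorem howeDer_mem_weightLT_one (x : HoweIndex k n) {m : ℕ}
    {f : MvPolynomial (Fin k × Fin n) ℂ} (hf : f ∈ weightLT (fun _ => 1) m) :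
    howeDer k n x f ∈ weightLT (fun _ => 1) m := by
  rcases x with ⟨a, b⟩ | ⟨a, b⟩ <;>
  · rw [howeDer, Derivation.finset_sum_apply]
    exact Submodule.sum_mem _ fun c _ => X_mul_pderiv_mem_weightLT
      (w := fun _ => 1) (m := m) (d := 0) le_rfl (by rwa [add_zero])

instance finiteDimensional_weightLT_one (m : ℕ) :
    FiniteDimensional ℂ (weightLT (k := k) (n := n) (fun _ => 1) m) := by
  refine Submodule.finiteDimensional_of_le
    (S₂ := restrictTotalDegree (Fin k × Fin n) ℂ m) fun f hf => ?_
  rw [mem_restrictTotalDegree]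
  refine Finset.sup_le (f := fun α : Fin k × Fin n →₀ ℕ => α.sum fun _ e => e) fun α hα => ?_
  by_contra h
  refine mem_support_iff.mp hα (hf α ?_)
  rw [Finsupp.weight_apply]
  simp only [smul_eq_mul, mul_one]
  exact (not_le.mp h).le

/-- Vectors annihilated by all raising operators. -/
def IsSingular (f : MvPolynomial (Fin k × Fin n) ℂ) : Prop :=
  ∀ x : HoweIndex k n, x.Raising → howeDer k n x f = 0

/-- Submodules invariant under `gl_k ⊕ gl_n`. -/
def HoweInvariant (W : Submodule ℂ (MvPolynomial (Fin k × Fin n) ℂ)) : Prop :=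
  ∀ x, ∀ f ∈ W, howeDer k n x f ∈ W

theorem HoweInvariant.exists_isSingular {W : Submodule ℂ (MvPolynomial (Fin k × Fin n) ℂ)}
    (hW : HoweInvariant W) (hne : W ≠ ⊥) : ∃ f ∈ W, f ≠ 0 ∧ IsSingular f := by
  obtain ⟨f, hfW, hf0⟩ := W.ne_bot_iff.mp hne
  obtain ⟨m, hm⟩ := exists_mem_weightLT (fun s : Fin k × Fin n => (s.1 : ℕ) + s.2) f
  induction m generalizing f with
  | zero => exact absurd (MvPolynomial.ext _ _ fun α => by simpa using hm α (Nat.zero_le _)) hf0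
  | succ m ih =>
    by_cases hs : IsSingular f
    · exact ⟨f, hfW, hf0, hs⟩
    · simp only [IsSingular, not_forall] at hs
      obtain ⟨x, hx, hxf⟩ := hs
      exact ih _ (hW x f hfW) hxf (howeDer_mem_weightLT_of_raising hx hm)

theorem HoweInvariant.fischerPerp {W : Submodule ℂ (MvPolynomial (Fin k × Fin n) ℂ)}
    (hW : HoweInvariant W) :
    HoweInvariant (_root_.fischerPerp (W : Set (MvPolynomial (Fin k × Fin n) ℂ))) :=
  fun x f hf g hg => by
    rw [← x.swap_swap, ← fischer_howeDer]
    exact hf _ (hW _ g hg)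

end Operators

/-! ### Leading minors and singular vectors -/

section Minors

variable {k n : ℕ}

/-- The upper left square block of size `j + 1`. -/
def leadingBlock {R : Type*} (j : Fin (min k n)) (A : Fin k × Fin n → R) :
    Matrix (Fin (j + 1)) (Fin (j + 1)) R :=
  Matrix.of fun r c =>
    A (Fin.castLE (j.2.trans_le (min_le_left k n)) r,
      Fin.castLE (j.2.trans_le (min_le_right k n)) c)

/-- The leading principal minors of the generic matrix. -/
noncomputable def leadingMinor (j : Fin (min k n)) : MvPolynomial (Fin k × Fin n) ℂ :=
  (leadingBlock j X).det

theorem eval_leadingMinor (A : Fin k × Fin n → ℂ) (j : Fin (min k n)) :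
    eval A (leadingMinor j) = (leadingBlock j A).det := by
  rw [leadingMinor, RingHom.map_det]
  congr 1
  ext r c
  simp [leadingBlock]

theorem Derivation.map_det_of_row_shift {A : Type*} [CommRing A] [Algebra ℂ A] {N : ℕ}
    (D : Derivation ℂ A A) (M : Matrix (Fin N) (Fin N) A) {a b : ℕ} (hab : a ≤ b)
    (h0 : ∀ r c : Fin N, (r : ℕ) ≠ b → D (M r c) = 0)
    (h1 : ∀ r s c : Fin N, (r : ℕ) = b → (s : ℕ) = a → D (M r c) = M s c) :
    D M.det = (if a = b ∧ a < N then 1 else 0 : ℂ) • M.det := by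
  rw [D.map_det]
  by_cases hb : b < N
  · rw [Finset.sum_eq_single ⟨b, hb⟩]
    · have hrow : (fun c => D (M ⟨b, hb⟩ c)) = M ⟨a, hab.trans_lt hb⟩ :=
        _root_.funext fun c => h1 _ _ c rfl rfl
      rw [hrow]
      split_ifs with h
      · obtain ⟨rfl, -⟩ := h
        rw [Matrix.updateRow_eq_self, one_smul]
      · have hne : a ≠ b := fun e => h ⟨e, hab.trans_lt hb⟩
        have hne' : (⟨a, hab.trans_lt hb⟩ : Fin N) ≠ ⟨b, hb⟩ := fun e => hne (Fin.mk.inj e)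
        rw [zero_smul, Matrix.det_zero_of_row_eq hne']
        rw [Matrix.updateRow_ne hne', Matrix.updateRow_self]
    · intro r _ hr
      refine Matrix.det_eq_zero_of_row_eq_zero r fun c => ?_
      rw [Matrix.updateRow_self, h0 r c fun e => hr (Fin.ext e)]
    · simp
  · rw [if_neg (by omega), zero_smul]
    refine Finset.sum_eq_zero fun r _ => Matrix.det_eq_zero_of_row_eq_zero r fun c => ?_
    rw [Matrix.updateRow_self, h0 r c fun e => hb (e ▸ r.2)]

theorem howeDer_inl_leadingMinor {a b : Fin k} (hab : a ≤ b) (j : Fin (min k n)) :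
    howeDer k n (.inl (a, b)) (leadingMinor j) =
      (if (a : ℕ) = b ∧ (a : ℕ) < j + 1 then 1 else 0 : ℂ) • leadingMinor j := by
  refine Derivation.map_det_of_row_shift _ _ (Fin.le_def.mp hab) (fun r c hr => ?_)
    fun r s c hr hs => ?_
  · rw [leadingBlock, Matrix.of_apply, howeDer_inl_X, if_neg fun e => hr (congrArg Fin.val e)]
  · rw [leadingBlock, Matrix.of_apply, howeDer_inl_X, if_pos (Fin.ext hr), Matrix.of_apply]
    congr 2
    exact Fin.ext hs.symm

theorem howeDer_inr_leadingMinor {a b : Fin n} (hab : a ≤ b) (j : Fin (min k n)) :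
    howeDer k n (.inr (a, b)) (leadingMinor j) =
      (if (a : ℕ) = b ∧ (a : ℕ) < j + 1 then 1 else 0 : ℂ) • leadingMinor j := by
  rw [leadingMinor, ← Matrix.det_transpose]
  refine Derivation.map_det_of_row_shift _ _ (Fin.le_def.mp hab) (fun r c hr => ?_)
    fun r s c hr hs => ?_
  · rw [Matrix.transpose_apply, leadingBlock, Matrix.of_apply, howeDer_inr_X,
      if_neg fun e => hr (congrArg Fin.val e)]
  · rw [Matrix.transpose_apply, leadingBlock, Matrix.of_apply, howeDer_inr_X,
      if_pos (Fin.ext hr), Matrix.transpose_apply, Matrix.of_apply]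
    congr 2
    exact Fin.ext hs.symm

theorem isSingular_leadingMinor (j : Fin (min k n)) :
    IsSingular (leadingMinor j : MvPolynomial (Fin k × Fin n) ℂ) := by
  rintro (⟨a, b⟩ | ⟨a, b⟩) hx
  · have hab : a < b := hx
    rw [howeDer_inl_leadingMinor hab.le, if_neg fun h => hab.ne (Fin.ext h.1), zero_smul]
  · have hab : a < b := hx
    rw [howeDer_inr_leadingMinor hab.le, if_neg fun h => hab.ne (Fin.ext h.1), zero_smul]

theorem eval_leadingMinor_of_diagonal {B : Fin k × Fin n → ℂ} (j : Fin (min k n))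
    (hB : ∀ s, (s.1 : ℕ) ≠ s.2 → min (s.1 : ℕ) s.2 < j → B s = 0) :
    eval B (leadingMinor j) = ∏ r : Fin (j + 1), leadingBlock j B r r := by
  rw [eval_leadingMinor, ← Matrix.det_diagonal]
  congr 1
  ext r c
  rw [Matrix.diagonal_apply]
  split_ifs with h
  · rw [h]
  · have hne : (r : ℕ) ≠ c := fun e => h (Fin.ext e)
    refine hB _ hne ?_
    simp only [Fin.val_castLE]
    omega

theorem leadingMinor_ne_zero (j : Fin (min k n)) :
    (leadingMinor j : MvPolynomial (Fin k × Fin n) ℂ) ≠ 0 := fun h => by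
  have h1 := eval_leadingMinor_of_diagonal (k := k) (n := n) j
    (B := fun s => if (s.1 : ℕ) = s.2 then 1 else 0) fun s hs _ => if_neg hs
  rw [h, map_zero] at h1
  simp [leadingBlock] at h1

/-! ### Invariance of singular vectors under unipotent row and column operations -/

theorem IsSingular.eval_row_add {f : MvPolynomial (Fin k × Fin n) ℂ} (hf : IsSingular f)
    (p : Fin k) (N : Fin k → ℂ) (hN : ∀ b, b ≤ p → N b = 0) (A : Fin k × Fin n → ℂ) :
    eval (A + fun s => N s.1 * A (p, s.2)) f = eval A f := by
  refine eval_add_of_mkDerivation (fun s => C (N s.1) * X (p, s.2)) _ _ (fun t s => ?_) f ?_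
  · simp [hN p le_rfl]
  · have h : mkDerivation ℂ (fun s : Fin k × Fin n =>
        (C (N s.1) * X (p, s.2) : MvPolynomial (Fin k × Fin n) ℂ)) =
        ∑ b, N b • howeDer k n (.inl (p, b)) := by
      refine derivation_ext fun s => ?_
      rw [mkDerivation_X, Derivation.finset_sum_apply]
      simp only [Derivation.smul_apply, howeDer_inl_X]
      simp [C_mul']
    rw [h, Derivation.finset_sum_apply]
    refine Finset.sum_eq_zero fun b _ => ?_
    rw [Derivation.smul_apply]
    rcases le_or_gt b p with hb | hb
    · rw [hN b hb, zero_smul]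
    · rw [hf (.inl (p, b)) hb, smul_zero]

theorem IsSingular.eval_col_add {f : MvPolynomial (Fin k × Fin n) ℂ} (hf : IsSingular f)
    (p : Fin n) (N : Fin n → ℂ) (hN : ∀ b, b ≤ p → N b = 0) (A : Fin k × Fin n → ℂ) :
    eval (A + fun s => N s.2 * A (s.1, p)) f = eval A f := by
  refine eval_add_of_mkDerivation (fun s => C (N s.2) * X (s.1, p)) _ _ (fun t s => ?_) f ?_
  · simp [hN p le_rfl]
  · have h : mkDerivation ℂ (fun s : Fin k × Fin n =>
        (C (N s.2) * X (s.1, p) : MvPolynomial (Fin k × Fin n) ℂ)) =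
        ∑ b, N b • howeDer k n (.inr (p, b)) := by
      refine derivation_ext fun s => ?_
      rw [mkDerivation_X, Derivation.finset_sum_apply]
      simp only [Derivation.smul_apply, howeDer_inr_X]
      simp [C_mul']
    rw [h, Derivation.finset_sum_apply]
    refine Finset.sum_eq_zero fun b _ => ?_
    rw [Derivation.smul_apply]
    rcases le_or_gt b p with hb | hb
    · rw [hN b hb, zero_smul]
    · rw [hf (.inr (p, b)) hb, smul_zero]

/-- Gaussian elimination: a matrix with nonzero leading minors can be diagonalised by unipotent
row and column operations. -/
theorem exists_diagonal_eval_eq (A : Fin k × Fin n → ℂ)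
    (hA : ∀ j : Fin (min k n), eval A (leadingMinor j) ≠ 0) (p : ℕ) (hp : p ≤ min k n) :
    ∃ B : Fin k × Fin n → ℂ, (∀ f, IsSingular f → eval B f = eval A f) ∧
      ∀ s, (s.1 : ℕ) ≠ s.2 → min (s.1 : ℕ) s.2 < p → B s = 0 := by
  induction p with
  | zero => exact ⟨A, fun _ _ => rfl, fun s _ h => absurd h (Nat.not_lt_zero _)⟩
  | succ p ih =>
    obtain ⟨B, hB, hB0⟩ := ih (by omega)
    let P : Fin k := ⟨p, by omega⟩
    let Q : Fin n := ⟨p, by omega⟩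
    have hd : B (P, Q) ≠ 0 := fun h => by
      refine hA ⟨p, hp⟩ ?_
      rw [← hB _ (isSingular_leadingMinor _), eval_leadingMinor_of_diagonal _ hB0]
      exact Finset.prod_eq_zero (Finset.mem_univ (Fin.last p)) h
    let N : Fin k → ℂ := fun b => if P < b then -B (b, Q) / B (P, Q) else 0
    let M : Fin n → ℂ := fun i => if Q < i then -B (P, i) / B (P, Q) else 0
    have hN : ∀ b, b ≤ P → N b = 0 := fun b hb => if_neg hb.not_gt
    have hM : ∀ b, b ≤ Q → M b = 0 := fun b hb => if_neg hb.not_gt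
    let B' : Fin k × Fin n → ℂ := B + fun s => N s.1 * B (P, s.2)
    refine ⟨B' + fun s => M s.2 * B' (s.1, Q), fun f hf => ?_, ?_⟩
    · rw [hf.eval_col_add Q M hM, hf.eval_row_add P N hN, hB f hf]
    · rintro ⟨b, i⟩ hne hlt
      have hB' : ∀ c l, B' (c, l) = B (c, l) + N c * B (P, l) := fun _ _ => rfl
      simp only [Pi.add_apply, hB']
      simp only at hne hlt
      rcases lt_trichotomy (b : ℕ) p with hb | hb | hb
      · have hbP : b ≤ P := Fin.le_def.mpr hb.le
        rw [hN b hbP, hB0 (b, i) hne (by simp only; omega),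
          hB0 (b, Q) (by simp only [Q]; omega) (by simp only [Q]; omega)]
        ring
      · obtain rfl : b = P := Fin.ext hb
        rw [hN P le_rfl]
        rcases le_or_gt i Q with hi | hi
        · have : (i : ℕ) ≤ p := hi
          rw [hM i hi, hB0 (P, i) hne (by simp only [P]; omega)]
          ring
        · have hMi : M i = -B (P, i) / B (P, Q) := if_pos hi
          rw [hMi]
          field_simp
          ring
      · have hi : i ≤ Q := Fin.le_def.mpr (by simp only [Q]; omega)
        rw [hM i hi]
        have hNb : N b = -B (b, Q) / B (P, Q) := if_pos (Fin.lt_def.mpr hb)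
        rcases hi.lt_or_eq with hi | rfl
        · have : (i : ℕ) < p := hi
          rw [hB0 (b, i) hne (by simp only; omega),
            hB0 (P, i) (by simp only [P]; omega) (by simp only [P]; omega)]
          ring
        · rw [hNb]
          field_simp
          ring

theorem eq_of_diagonal_of_eval_leadingMinor {B B' : Fin k × Fin n → ℂ}
    (hB : ∀ s, (s.1 : ℕ) ≠ s.2 → B s = 0) (hB' : ∀ s, (s.1 : ℕ) ≠ s.2 → B' s = 0)
    (h : ∀ j : Fin (min k n), eval B (leadingMinor j) = eval B' (leadingMinor j))
    (h0 : ∀ j : Fin (min k n), eval B (leadingMinor j) ≠ 0) : B = B' := by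
  have key : ∀ t (hk : t < k) (hn : t < n), B (⟨t, hk⟩, ⟨t, hn⟩) = B' (⟨t, hk⟩, ⟨t, hn⟩) := by
    intro t
    induction t using Nat.strong_induction_on with
    | _ t ih =>
      intro hk hn
      have e := h ⟨t, lt_min hk hn⟩
      have e0 := h0 ⟨t, lt_min hk hn⟩
      rw [eval_leadingMinor_of_diagonal _ fun s hs _ => hB s hs] at e e0
      rw [eval_leadingMinor_of_diagonal _ fun s hs _ => hB' s hs] at e
      simp only [leadingBlock, Matrix.of_apply] at e e0
      rw [Fin.prod_univ_castSucc] at e e0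
      rw [Fin.prod_univ_castSucc] at e
      exact mul_left_cancel₀ (left_ne_zero_of_mul e0) (e.trans (congrArg (· * _)
        (Finset.prod_congr rfl fun r _ => (ih r r.2 (r.2.trans hk) (r.2.trans hn)).symm)))
  funext s
  obtain ⟨⟨a, ha⟩, ⟨i, hi⟩⟩ := s
  by_cases hs : a = i
  · subst hs
    exact key a ha hi
  · rw [hB _ hs, hB' _ hs]

theorem IsSingular.eval_eq_of_eval_leadingMinor {f : MvPolynomial (Fin k × Fin n) ℂ}
    (hf : IsSingular f) {A A' : Fin k × Fin n → ℂ}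
    (h : ∀ j : Fin (min k n), eval A (leadingMinor j) = eval A' (leadingMinor j))
    (h0 : ∀ j : Fin (min k n), eval A (leadingMinor j) ≠ 0) : eval A f = eval A' f := by
  obtain ⟨B, hB, hBd⟩ := exists_diagonal_eval_eq A h0 _ le_rfl
  obtain ⟨B', hB', hBd'⟩ := exists_diagonal_eval_eq A' (fun j => h j ▸ h0 j) _ le_rfl
  have hlt : ∀ s : Fin k × Fin n, min (s.1 : ℕ) s.2 < min k n := fun s => by omega
  have hs := fun j => isSingular_leadingMinor (k := k) (n := n) j
  rw [← hB f hf, ← hB' f hf, eq_of_diagonal_of_eval_leadingMinor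
    (fun s e => hBd s e (hlt s)) (fun s e => hBd' s e (hlt s))
    (fun j => by rw [hB _ (hs j), hB' _ (hs j), h j]) (fun j => by rw [hB _ (hs j)]; exact h0 j)]

/-- A matrix with prescribed leading minors, depending polynomially on them. -/
def companionEntries {R : Type*} [Ring R] (y : Fin (min k n) → R) (s : Fin k × Fin n) : R :=
  if (s.1 : ℕ) = 0 then (if h : (s.2 : ℕ) < min k n then y ⟨s.2, h⟩ else 0)
  else if (s.1 : ℕ) = s.2 + 1 then -1 else 0

theorem companionEntries_of_val_eq_zero {R : Type*} [Ring R] (y : Fin (min k n) → R)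
    {a : Fin k} {i : Fin n} (h : (a : ℕ) = 0) (j : Fin (min k n)) (hj : (i : ℕ) = j) :
    companionEntries y (a, i) = y j := by
  rw [companionEntries, if_pos h, dif_pos (hj ▸ j.2)]
  exact congrArg y (Fin.ext hj)

theorem companionEntries_of_val_ne_zero {R : Type*} [Ring R] (y : Fin (min k n) → R)
    {a : Fin k} {i : Fin n} (h : (a : ℕ) ≠ 0) :
    companionEntries y (a, i) = if (a : ℕ) = i + 1 then -1 else 0 :=
  if_neg h

theorem eval_companionEntries (y : Fin (min k n) → ℂ) (s : Fin k × Fin n) :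
    eval y (companionEntries X s) = companionEntries y s := by
  unfold companionEntries
  split_ifs <;> simp

theorem eval_leadingMinor_companionEntries (y : Fin (min k n) → ℂ) (j : Fin (min k n)) :
    eval (companionEntries y) (leadingMinor j) = y j := by
  rw [eval_leadingMinor, Matrix.det_succ_column _ (Fin.last _), Finset.sum_eq_single 0]
  · have hM : (leadingBlock j (companionEntries y)).submatrix (Fin.succAbove 0)
        (Fin.succAbove (Fin.last _)) = Matrix.diagonal fun _ => -1 := by
      ext r c
      rw [Matrix.diagonal_apply, Matrix.submatrix_apply, Fin.succAbove_zero, Fin.succAbove_last]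
      refine (companionEntries_of_val_ne_zero y (a := Fin.castLE _ r.succ)
        (i := Fin.castLE _ c.castSucc) (Nat.succ_ne_zero r)).trans
        (if_congr ?_ rfl rfl)
      rw [Fin.ext_iff]
      exact Nat.succ_inj
    have h0 : leadingBlock j (companionEntries y) 0 (Fin.last _) = y j :=
      companionEntries_of_val_eq_zero y (a := Fin.castLE _ (0 : Fin (j + 1)))
        (i := Fin.castLE _ (Fin.last _)) rfl j rfl
    rw [hM, h0, Matrix.det_diagonal, Finset.prod_const, Finset.card_univ, Fintype.card_fin,
      Fin.val_zero, Fin.val_last, zero_add, mul_right_comm, ← mul_pow]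
    simp
  · intro r _ hr
    have hz : leadingBlock j (companionEntries y) r (Fin.last _) = 0 :=
      (companionEntries_of_val_ne_zero y (a := Fin.castLE _ r) (i := Fin.castLE _ (Fin.last _))
        fun e => hr (Fin.ext e)).trans (if_neg r.2.ne)
    rw [hz]
    ring
  · simp

theorem eval_aeval {σ τ : Type*} (A : τ → ℂ) (φ : σ → MvPolynomial τ ℂ) (q : MvPolynomial σ ℂ) :
    eval A (aeval φ q) = eval (fun i => eval A (φ i)) q := by
  induction q using MvPolynomial.induction_on with
  | C a => simp
  | add p q hp hq => rw [map_add, map_add, hp, hq, map_add]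
  | mul_X p i hp => rw [map_mul, map_mul, hp, aeval_X, map_mul, eval_X]

theorem IsSingular.exists_eq_aeval {f : MvPolynomial (Fin k × Fin n) ℂ} (hf : IsSingular f) :
    ∃ q : MvPolynomial (Fin (min k n)) ℂ, f = aeval leadingMinor q := by
  refine ⟨aeval (companionEntries X) f, ?_⟩
  have h : (f - aeval leadingMinor (aeval (companionEntries X) f : MvPolynomial _ ℂ)) *
      ∏ j, leadingMinor j = 0 := by
    refine MvPolynomial.funext fun A => ?_
    rw [map_mul, map_sub, eval_aeval, eval_aeval, map_prod, map_zero]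
    simp only [eval_companionEntries]
    by_cases h0 : ∀ j : Fin (min k n), eval A (leadingMinor j) ≠ 0
    · have hA := hf.eval_eq_of_eval_leadingMinor
        (A' := companionEntries fun j => eval A (leadingMinor j))
        (fun j => (eval_leadingMinor_companionEntries
          (fun j => eval A (leadingMinor j)) j).symm) h0
      rw [← hA, sub_self, zero_mul]
    · push Not at h0
      obtain ⟨j, hj⟩ := h0
      rw [Finset.prod_eq_zero (Finset.mem_univ j) hj, mul_zero]
  exact sub_eq_zero.mp ((mul_eq_zero.mp h).resolve_right
    (Finset.prod_ne_zero_iff.mpr fun j _ => leadingMinor_ne_zero j))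

end Minors

/-! ### Highest weight vectors -/

section HighestWeight

variable {k n : ℕ}

/-- The parts of a partition, extended by zeros. -/
def PartitionKN.part (mu : PartitionKN k n) (t : ℕ) : ℕ :=
  if h : t < min k n then mu.1 ⟨t, h⟩ else 0

theorem PartitionKN.part_of_le (mu : PartitionKN k n) {t : ℕ} (h : min k n ≤ t) :
    mu.part t = 0 :=
  dif_neg h.not_gt

theorem PartitionKN.part_succ_le (mu : PartitionKN k n) (t : ℕ) :
    mu.part (t + 1) ≤ mu.part t := by
  rcases lt_or_ge (t + 1) (min k n) with h | h
  · rw [part, part, dif_pos h, dif_pos (t.lt_succ_self.trans h)]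
    exact mu.2 (Fin.mk_le_mk.mpr t.le_succ)
  · rw [mu.part_of_le h]
    exact Nat.zero_le _

theorem PartitionKN.exists_part_ne {mu nu : PartitionKN k n} (h : mu ≠ nu) :
    ∃ t < min k n, mu.part t ≠ nu.part t := by
  by_contra! hp
  refine h (Subtype.ext (_root_.funext fun j => ?_))
  have h' := hp j j.2
  rwa [part, part, dif_pos j.2, dif_pos j.2] at h'

theorem PartitionKN.sum_part_sub (mu : PartitionKN k n) (t : ℕ) :
    ∑ j : Fin (min k n), (if t ≤ j then mu.part j - mu.part (j + 1) else 0) = mu.part t := by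
  rw [Fin.sum_univ_eq_sum_range fun j => if t ≤ j then mu.part j - mu.part (j + 1) else 0]
  have key : ∀ M, ∑ j ∈ Finset.range M,
      (if t ≤ j then mu.part j - mu.part (j + 1) else 0) + mu.part (max t M) = mu.part t := by
    intro M
    induction M with
    | zero => simp
    | succ M ih =>
      rw [Finset.sum_range_succ]
      split_ifs with h
      · rw [max_eq_right h] at ih
        rw [max_eq_right (by omega : t ≤ M + 1)]
        have := mu.part_succ_le M
        omega
      · rw [max_eq_left (by omega)] at ih ⊢
        exact ih
  have := key (min k n)
  rwa [mu.part_of_le (le_max_right _ _), add_zero] at this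

theorem PartitionKN.exists_part_sub_eq (γ : Fin (min k n) → ℕ) :
    ∃ mu : PartitionKN k n, ∀ j : Fin (min k n), mu.part j - mu.part (j + 1) = γ j := by
  let L : ℕ → ℕ := fun t => ∑ i : Fin (min k n), if t ≤ i then γ i else 0
  have hanti : Antitone L := fun s t hst => Finset.sum_le_sum fun i _ => by
    split_ifs <;> omega
  let mu : PartitionKN k n := ⟨fun j => L j, fun _ _ h => hanti h⟩
  have hpart : ∀ t, mu.part t = L t := fun t => by
    unfold part
    split_ifs with h
    · rfl
    · exact (Finset.sum_eq_zero fun i _ => if_neg (by omega)).symm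
  have hL : ∀ j : Fin (min k n), L j = L (j + 1) + γ j := fun j => by
    have hγ : γ j = ∑ i : Fin (min k n), if i = j then γ i else 0 := by simp
    rw [hγ, ← Finset.sum_add_distrib]
    refine Finset.sum_congr rfl fun i _ => ?_
    simp only [Fin.ext_iff]
    split_ifs <;> omega
  exact ⟨mu, fun j => by rw [hpart, hpart, hL j, Nat.add_sub_cancel_left]⟩

/-- The joint highest weight vector attached to a partition: a product of powers of leading
minors. -/
noncomputable def highestWeightVector (mu : PartitionKN k n) : MvPolynomial (Fin k × Fin n) ℂ :=
  ∏ j : Fin (min k n), leadingMinor j ^ (mu.part j - mu.part (j + 1))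

theorem highestWeightVector_ne_zero (mu : PartitionKN k n) : highestWeightVector mu ≠ 0 :=
  Finset.prod_ne_zero_iff.mpr fun j _ => pow_ne_zero _ (leadingMinor_ne_zero j)

theorem isSingular_highestWeightVector (mu : PartitionKN k n) :
    IsSingular (highestWeightVector mu) := fun x hx => by
  rw [highestWeightVector, Derivation.map_prod_pow_of_eigen _ _ _ (fun _ => 0) fun j => by
    rw [isSingular_leadingMinor j x hx, zero_smul]]
  simp

theorem PartitionKN.sum_part_sub_mul (mu : PartitionKN k n) (t : ℕ) :
    ∑ j : Fin (min k n), ((mu.part j - mu.part (j + 1) : ℕ) : ℂ) *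
      (if t = t ∧ t < j + 1 then 1 else 0) = mu.part t := by
  conv_rhs => rw [← mu.sum_part_sub t]
  push_cast
  refine Finset.sum_congr rfl fun j _ => ?_
  simp

theorem howeDer_inl_highestWeightVector (mu : PartitionKN k n) (a : Fin k) :
    howeDer k n (.inl (a, a)) (highestWeightVector mu) =
      (mu.part a : ℂ) • highestWeightVector mu := by
  rw [highestWeightVector, Derivation.map_prod_pow_of_eigen _ _ _ _
    fun j => howeDer_inl_leadingMinor le_rfl j, mu.sum_part_sub_mul]

theorem howeDer_inr_highestWeightVector (mu : PartitionKN k n) (i : Fin n) :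
    howeDer k n (.inr (i, i)) (highestWeightVector mu) =
      (mu.part i : ℂ) • highestWeightVector mu := by
  rw [highestWeightVector, Derivation.map_prod_pow_of_eigen _ _ _ _
    fun j => howeDer_inr_leadingMinor le_rfl j, mu.sum_part_sub_mul]

theorem IsSingular.mem_span_highestWeightVector {f : MvPolynomial (Fin k × Fin n) ℂ}
    (hf : IsSingular f) :
    f ∈ Submodule.span ℂ (Set.range (highestWeightVector (k := k) (n := n))) := by
  obtain ⟨q, rfl⟩ := hf.exists_eq_aeval
  rw [aeval_def, eval₂_eq']
  refine Submodule.sum_mem _ fun d _ => ?_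
  rw [← Algebra.smul_def]
  obtain ⟨mu, hmu⟩ := PartitionKN.exists_part_sub_eq (k := k) (n := n) d
  refine Submodule.smul_mem _ _ (Submodule.subset_span ⟨mu, ?_⟩)
  simp only [highestWeightVector, hmu]

theorem fischer_highestWeightVector {mu nu : PartitionKN k n} (h : mu ≠ nu) :
    fischer (highestWeightVector mu) (highestWeightVector nu) = 0 := by
  obtain ⟨t, ht, hne⟩ := PartitionKN.exists_part_ne h
  let a : Fin k := ⟨t, ht.trans_le (min_le_left _ _)⟩
  have hD : fischer (howeDer k n (.inl (a, a)) (highestWeightVector mu)) (highestWeightVector nu) =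
      fischer (highestWeightVector mu) (howeDer k n (.inl (a, a)) (highestWeightVector nu)) :=
    fischer_howeDer _ _ _
  rw [howeDer_inl_highestWeightVector, howeDer_inl_highestWeightVector, fischer_smul_left,
    fischer_smul_right, star_natCast] at hD
  by_contra h0
  exact hne (Nat.cast_injective (mul_right_cancel₀ h0 hD))

/-! ### Isotypic components -/

/-- The subspace generated by the highest weight vector under the lowering operators. -/
noncomputable def howeComponent (mu : PartitionKN k n) :
    Submodule ℂ (MvPolynomial (Fin k × Fin n) ℂ) :=
  sInf {W | highestWeightVector mu ∈ W ∧
    ∀ x : HoweIndex k n, x.swap.Raising → ∀ f ∈ W, howeDer k n x f ∈ W}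

theorem howeComponent_le {mu : PartitionKN k n}
    {W : Submodule ℂ (MvPolynomial (Fin k × Fin n) ℂ)} (hv : highestWeightVector mu ∈ W)
    (hW : ∀ x : HoweIndex k n, x.swap.Raising → ∀ f ∈ W, howeDer k n x f ∈ W) :
    howeComponent mu ≤ W :=
  sInf_le ⟨hv, hW⟩

theorem highestWeightVector_mem (mu : PartitionKN k n) :
    highestWeightVector mu ∈ howeComponent mu :=
  Submodule.mem_sInf.mpr fun _ hW => hW.1

theorem howeDer_mem_howeComponent_of_lowering {mu : PartitionKN k n} {x : HoweIndex k n}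
    (hx : x.swap.Raising) {f : MvPolynomial (Fin k × Fin n) ℂ} (hf : f ∈ howeComponent mu) :
    howeDer k n x f ∈ howeComponent mu :=
  Submodule.mem_sInf.mpr fun W hW => hW.2 x hx f (Submodule.mem_sInf.mp hf W hW)

theorem howeDer_highestWeightVector_mem (mu : PartitionKN k n) (x : HoweIndex k n) :
    howeDer k n x (highestWeightVector mu) ∈ howeComponent mu := by
  have hv := highestWeightVector_mem mu
  rcases x with ⟨a, b⟩ | ⟨a, b⟩ <;> rcases lt_trichotomy a b with h | rfl | h
  · rw [isSingular_highestWeightVector mu (.inl (a, b)) h]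
    exact Submodule.zero_mem _
  · rw [howeDer_inl_highestWeightVector]
    exact Submodule.smul_mem _ _ hv
  · exact howeDer_mem_howeComponent_of_lowering (x := .inl (a, b)) h hv
  · rw [isSingular_highestWeightVector mu (.inr (a, b)) h]
    exact Submodule.zero_mem _
  · rw [howeDer_inr_highestWeightVector]
    exact Submodule.smul_mem _ _ hv
  · exact howeDer_mem_howeComponent_of_lowering (x := .inr (a, b)) h hv

theorem howeInvariant_howeComponent (mu : PartitionKN k n) :
    HoweInvariant (howeComponent mu) := by
  let U : Submodule ℂ (MvPolynomial (Fin k × Fin n) ℂ) :=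
    howeComponent mu ⊓ ⨅ x, (howeComponent mu).comap (howeDer k n x).toLinearMap
  have hU : ∀ u, u ∈ U ↔ u ∈ howeComponent mu ∧ ∀ x, howeDer k n x u ∈ howeComponent mu :=
    fun u => by simp [U]
  have hle : howeComponent mu ≤ U := by
    refine howeComponent_le ((hU _).mpr ⟨highestWeightVector_mem mu,
      howeDer_highestWeightVector_mem mu⟩) fun y hy u hu => ?_
    obtain ⟨-, hu⟩ := (hU u).mp hu
    refine (hU _).mpr ⟨hu y, fun x => ?_⟩
    have hspan : ∀ D ∈ Submodule.span ℂ (Set.range (howeDer k n)), D u ∈ howeComponent mu := by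
      intro D hD
      induction hD using Submodule.span_induction with
      | mem D hD =>
        obtain ⟨z, rfl⟩ := hD
        exact hu z
      | zero => exact Submodule.zero_mem _
      | add D E _ _ hD hE => exact Submodule.add_mem _ hD hE
      | smul c D _ hD => exact Submodule.smul_mem _ c hD
    have hlie := hspan _ (howeDer_lie_mem x y)
    rw [Derivation.commutator_apply] at hlie
    have := Submodule.add_mem _ hlie (howeDer_mem_howeComponent_of_lowering hy (hu x))
    rwa [sub_add_cancel] at this
  exact fun x f hf => ((hU f).mp (hle hf)).2 x

theorem HoweInvariant.howeComponent_le {W : Submodule ℂ (MvPolynomial (Fin k × Fin n) ℂ)}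
    (hW : HoweInvariant W) {mu : PartitionKN k n} (hv : highestWeightVector mu ∈ W) :
    howeComponent mu ≤ W :=
  _root_.howeComponent_le hv fun x _ => hW x

theorem highestWeightVector_mem_fischerPerp {mu nu : PartitionKN k n} (h : nu ≠ mu) :
    highestWeightVector nu ∈ fischerPerp (howeComponent mu : Set _) := by
  have hle : howeComponent mu ≤ fischerPerp {highestWeightVector nu} := by
    refine howeComponent_le (mem_fischerPerp.mpr ?_) fun y hy u hu => mem_fischerPerp.mpr ?_
    · rintro _ rfl
      exact fischer_highestWeightVector h
    · rintro _ rfl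
      rw [← y.swap_swap, ← fischer_howeDer, isSingular_highestWeightVector nu _ hy,
        fischer_zero_left]
  exact fun g hg => fischer_eq_zero_comm.mp (hle hg _ rfl)

theorem howeComponent_le_fischerPerp {mu nu : PartitionKN k n} (h : nu ≠ mu) :
    howeComponent nu ≤ fischerPerp (howeComponent mu : Set _) :=
  (howeInvariant_howeComponent mu).fischerPerp.howeComponent_le
    (highestWeightVector_mem_fischerPerp h)

theorem HoweInvariant.eq_howeComponent {W : Submodule ℂ (MvPolynomial (Fin k × Fin n) ℂ)}
    (hW : HoweInvariant W) {mu : PartitionKN k n} (hle : W ≤ howeComponent mu) (hne : W ≠ ⊥) :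
    W = howeComponent mu := by
  obtain ⟨w, hwW, hw0, hws⟩ := hW.exists_isSingular hne
  have hw := hws.mem_span_highestWeightVector
  have hsub : Set.range (highestWeightVector (k := k) (n := n)) ⊆
      insert (highestWeightVector mu) (highestWeightVector '' {mu}ᶜ) := by
    rintro _ ⟨nu, rfl⟩
    by_cases h : nu = mu
    · exact Or.inl (h ▸ rfl)
    · exact Or.inr ⟨nu, h, rfl⟩
  obtain ⟨c, u, hu, rfl⟩ := Submodule.mem_span_insert.mp (Submodule.span_mono hsub hw)
  have huperp : u ∈ _root_.fischerPerp (howeComponent mu : Set _) := by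
    refine Submodule.span_le.mpr ?_ hu
    rintro _ ⟨nu, hnu, rfl⟩
    exact highestWeightVector_mem_fischerPerp hnu
  have hv := highestWeightVector_mem mu
  have hu0 : u = 0 := by
    refine eq_zero_of_fischer_self (huperp u ?_)
    exact (Submodule.add_mem_iff_right _ (Submodule.smul_mem _ c hv)).mp (hle hwW)
  subst hu0
  rw [add_zero] at hwW hw0
  refine le_antisymm hle (hW.howeComponent_le ?_)
  exact (Submodule.smul_mem_iff _ (left_ne_zero_of_smul hw0)).mp hwW

theorem iSupIndep_howeComponent : iSupIndep (howeComponent (k := k) (n := n)) := by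
  intro mu
  rw [Submodule.disjoint_def]
  intro f hf hf'
  have hle : ⨆ (nu) (_ : nu ≠ mu), howeComponent (k := k) (n := n) nu ≤
      fischerPerp (howeComponent mu : Set _) :=
    iSup₂_le fun nu h => howeComponent_le_fischerPerp h
  exact eq_zero_of_fischer_self (hle hf' f hf)

theorem iSup_howeComponent : ⨆ mu, howeComponent (k := k) (n := n) mu = ⊤ := by
  set T := ⨆ mu, howeComponent (k := k) (n := n) mu with hT
  have hTinv : HoweInvariant T := fun x => by
    have h : T ≤ T.comap (howeDer k n x).toLinearMap := iSup_le fun mu f hf =>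
      (le_iSup howeComponent mu : howeComponent mu ≤ T) (howeInvariant_howeComponent mu x f hf)
    exact fun f hf => h hf
  refine eq_top_iff.mpr fun p _ => ?_
  obtain ⟨d, hd⟩ := exists_mem_weightLT (fun _ => 1) p
  let R := weightLT (k := k) (n := n) (fun _ => 1) d
  have hK : HoweInvariant (T ⊓ R) := fun x f hf =>
    ⟨hTinv x f hf.1, howeDer_mem_weightLT_one x hf.2⟩
  have : FiniteDimensional ℂ R := finiteDimensional_weightLT_one d
  have : FiniteDimensional ℂ ↥(T ⊓ R) := Submodule.finiteDimensional_of_le inf_le_right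
  have hQ : HoweInvariant (R ⊓ fischerPerp ((T ⊓ R : Submodule ℂ _) : Set _)) :=
    fun x f hf => ⟨howeDer_mem_weightLT_one x hf.1, hK.fischerPerp x f hf.2⟩
  have hQ0 : R ⊓ fischerPerp ((T ⊓ R : Submodule ℂ _) : Set _) = ⊥ := by
    by_contra hne
    obtain ⟨f, hf, hf0, hfs⟩ := hQ.exists_isSingular hne
    have hfT : f ∈ T := by
      refine Submodule.span_le.mpr ?_ hfs.mem_span_highestWeightVector
      rintro _ ⟨mu, rfl⟩
      exact (le_iSup howeComponent mu : howeComponent mu ≤ T) (highestWeightVector_mem mu)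
    exact hf0 (eq_zero_of_fischer_self (hf.2 f ⟨hfT, hf.1⟩))
  obtain ⟨q, hq, hpq⟩ := fischerPerp_sub_mem_of_finite (T ⊓ R) p
  have hmem : p - q ∈ R ⊓ fischerPerp ((T ⊓ R : Submodule ℂ _) : Set _) :=
    ⟨Submodule.sub_mem _ hd hq.2, hpq⟩
  rw [hQ0, Submodule.mem_bot, sub_eq_zero] at hmem
  exact hmem ▸ hq.1

end HighestWeight

theorem howe_duality (k n : ℕ) :
    ∃ S : PartitionKN k n → Submodule ℂ (MvPolynomial (Fin k × Fin n) ℂ),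
      DirectSum.IsInternal S ∧
      ∀ mu : PartitionKN k n,
        (∀ (a b : Fin k), ∀ x ∈ S mu, glkOp k n a b x ∈ S mu) ∧
        (∀ (i j : Fin n), ∀ x ∈ S mu, glnOp k n i j x ∈ S mu) ∧
        (∃ v ∈ S mu, v ≠ 0 ∧
          (∀ a b : Fin k, a < b → glkOp k n a b v = 0) ∧
          (∀ i j : Fin n, i < j → glnOp k n i j v = 0) ∧
          (∀ a : Fin k, glkOp k n a a v = (wtK k n mu a : ℂ) • v) ∧
          (∀ i : Fin n, glnOp k n i i v = (wtN k n mu i : ℂ) • v)) ∧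
        (∀ W : Submodule ℂ (MvPolynomial (Fin k × Fin n) ℂ), W ≤ S mu →
          (∀ (a b : Fin k), ∀ x ∈ W, glkOp k n a b x ∈ W) →
          (∀ (i j : Fin n), ∀ x ∈ W, glnOp k n i j x ∈ W) →
          W = ⊥ ∨ W = S mu) := by
  refine ⟨howeComponent, DirectSum.isInternal_submodule_iff_iSupIndep_and_iSup_eq_top _ |>.mpr
    ⟨iSupIndep_howeComponent, iSup_howeComponent⟩, fun mu => ?_⟩
  simp only [glkOp_apply, glnOp_apply]
  refine ⟨fun a b => howeInvariant_howeComponent mu (.inl (a, b)),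
    fun i j => howeInvariant_howeComponent mu (.inr (i, j)),
    ⟨highestWeightVector mu, highestWeightVector_mem mu, highestWeightVector_ne_zero mu,
      fun a b h => isSingular_highestWeightVector mu (.inl (a, b)) h,
      fun i j h => isSingular_highestWeightVector mu (.inr (i, j)) h,
      howeDer_inl_highestWeightVector mu, howeDer_inr_highestWeightVector mu⟩,
    fun W hle hk hn => or_iff_not_imp_left.mpr fun hne => ?_⟩
  refine HoweInvariant.eq_howeComponent (fun x => ?_) hle hne
  rcases x with ⟨a, b⟩ | ⟨i, j⟩
  · exact hk a b
  · exact hn i j
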